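/- arXiv:math/0601404 — 6 statements merged into one kernel-verified Lean document; each statement's English description precedes it below -/
import Mathlib

section
/- Assume 0 < a_i < 1 for all i. If (Q_0,...,Q_N) is any vector with Q_i ≥ 0 for all i, Σ_{i=0}^{N} Q_i = 1, and Q_i = p_{i-1}·Q_{i-1} + r_i·Q_i + q_{i+1}·Q_{i+1} for every 0 ≤ i ≤ N (with the convention Q_{-1} = Q_{N+1} = 0), then Q_i = Π_i/Z for every i; that is, the stationary distribution is unique and given by the product formula. -/
open Finset

/-- Winning probability of game B at state `i` for parameters `p1, p2, p3`,
with `round x` the nearest integer to `x`. -/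
noncomputable def gameB (N : ℕ) (p1 p2 p3 : ℝ) (i : ℕ) : ℝ :=
  if round ((2 * N : ℝ) / 3) < (i : ℤ) then p1
  else if round ((N : ℝ) / 3) ≤ (i : ℤ) then p2
  else p3

/-- `a i = γ·pA + (1-γ)·p^B_i`. -/
noncomputable def aProb (N : ℕ) (pA p1 p2 p3 γ : ℝ) (i : ℕ) : ℝ :=
  γ * pA + (1 - γ) * gameB N p1 p2 p3 i

/-- Forward transition probability `p_i = ((N-i)/N)·a_i`. -/
noncomputable def fwd (N : ℕ) (pA p1 p2 p3 γ : ℝ) (i : ℕ) : ℝ :=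
  (((N : ℝ) - (i : ℝ)) / (N : ℝ)) * aProb N pA p1 p2 p3 γ i

/-- Backward transition probability `q_i = (i/N)·(1-a_i)`. -/
noncomputable def bwd (N : ℕ) (pA p1 p2 p3 γ : ℝ) (i : ℕ) : ℝ :=
  ((i : ℝ) / (N : ℝ)) * (1 - aProb N pA p1 p2 p3 γ i)

/-- Staying probability `r_i = 1 - p_i - q_i`. -/
noncomputable def stay (N : ℕ) (pA p1 p2 p3 γ : ℝ) (i : ℕ) : ℝ :=
  1 - fwd N pA p1 p2 p3 γ i - bwd N pA p1 p2 p3 γ i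

/-- Unnormalized stationary weight `Π_i = (∏_{j=0}^{i-1} p_j)·(∏_{j=i+1}^{N} q_j)`. -/
noncomputable def wt (N : ℕ) (pA p1 p2 p3 γ : ℝ) (i : ℕ) : ℝ :=
  (∏ j ∈ Finset.range i, fwd N pA p1 p2 p3 γ j) *
    (∏ j ∈ Finset.Icc (i + 1) N, bwd N pA p1 p2 p3 γ j)

/-- Normalization `Z = Σ_{i=0}^{N} Π_i`. -/
noncomputable def Znorm (N : ℕ) (pA p1 p2 p3 γ : ℝ) : ℝ :=
  ∑ i ∈ Finset.range (N + 1), wt N pA p1 p2 p3 γ i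

/-- Stationary probability `P^st_i = Π_i / Z`. -/
noncomputable def Pst (N : ℕ) (pA p1 p2 p3 γ : ℝ) (i : ℕ) : ℝ :=
  wt N pA p1 p2 p3 γ i / Znorm N pA p1 p2 p3 γ

/-- Average winning probability `p_win = Σ_{i=0}^{N} a_i · P^st_i`. -/
noncomputable def pwin (N : ℕ) (pA p1 p2 p3 γ : ℝ) : ℝ :=
  ∑ i ∈ Finset.range (N + 1), aProb N pA p1 p2 p3 γ i * Pst N pA p1 p2 p3 γ i

/-- Current `J = 2·p_win - 1`. -/
noncomputable def current (N : ℕ) (pA p1 p2 p3 γ : ℝ) : ℝ :=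
  2 * pwin N pA p1 p2 p3 γ - 1

/-- Stationarity of a birth-death chain on `{0, …, N}` implies detailed balance: the net flow
between neighbouring states vanishes. -/
theorem detailed_balance_of_stationary {N : ℕ} {p q Q : ℕ → ℝ} (hq : q 0 = 0)
    (hQ : ∀ i ≤ N, Q i = (if i = 0 then 0 else p (i - 1) * Q (i - 1)) +
      (1 - p i - q i) * Q i + (if i = N then 0 else q (i + 1) * Q (i + 1))) :
    ∀ i < N, p i * Q i = q (i + 1) * Q (i + 1) := by
  intro i
  induction i with
  | zero =>
    intro h
    have := hQ 0 h.le
    simp only [if_true, if_neg h.ne, hq] at this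
    linarith
  | succ k ih =>
    intro h
    have := hQ (k + 1) h.le
    simp only [if_neg k.succ_ne_zero, if_neg h.ne, Nat.add_sub_cancel] at this
    linarith [ih (by omega)]

/-- Detailed balance determines a vector up to a scalar. -/
theorem mul_eq_mul_of_detailed_balance {N : ℕ} {p q Q W : ℕ → ℝ}
    (hq : ∀ i < N, q (i + 1) ≠ 0)
    (hQ : ∀ i < N, p i * Q i = q (i + 1) * Q (i + 1))
    (hW : ∀ i < N, p i * W i = q (i + 1) * W (i + 1)) :
    ∀ i ≤ N, Q i * W 0 = Q 0 * W i := by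
  intro i
  induction i with
  | zero => simp
  | succ k ih =>
    intro h
    apply mul_left_cancel₀ (hq k h)
    linear_combination p k * ih (by omega) - W 0 * hQ k h + Q 0 * hW k h

theorem fwd_mul_wt {N : ℕ} (pA p1 p2 p3 γ : ℝ) {i : ℕ} (hi : i < N) :
    fwd N pA p1 p2 p3 γ i * wt N pA p1 p2 p3 γ i =
      bwd N pA p1 p2 p3 γ (i + 1) * wt N pA p1 p2 p3 γ (i + 1) := by
  simp only [wt]
  rw [Finset.prod_range_succ, ← Finset.insert_Icc_add_one_left_eq_Icc (show i + 1 ≤ N from hi),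
    Finset.prod_insert (by simp)]
  ring

/-- uniqueness of the stationary distribution: any nonnegative, normalized
solution of the stationarity equations equals the product-form distribution `Π_i/Z`. -/
theorem stationary_unique (N : ℕ) (hN : 1 ≤ N) (pA p1 p2 p3 γ : ℝ)
    (hpA : pA ∈ Set.Icc (0 : ℝ) 1) (hp1 : p1 ∈ Set.Icc (0 : ℝ) 1)
    (hp2 : p2 ∈ Set.Icc (0 : ℝ) 1) (hp3 : p3 ∈ Set.Icc (0 : ℝ) 1)
    (hγ : γ ∈ Set.Icc (0 : ℝ) 1)
    (ha : ∀ i ≤ N, aProb N pA p1 p2 p3 γ i ∈ Set.Ioo (0 : ℝ) 1)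
    (Q : ℕ → ℝ)
    (hQpos : ∀ i ≤ N, 0 ≤ Q i)
    (hQsum : ∑ i ∈ Finset.range (N + 1), Q i = 1)
    (hQstat : ∀ i ≤ N,
      Q i = (if i = 0 then 0 else fwd N pA p1 p2 p3 γ (i - 1) * Q (i - 1)) +
        stay N pA p1 p2 p3 γ i * Q i +
        (if i = N then 0 else bwd N pA p1 p2 p3 γ (i + 1) * Q (i + 1))) :
    ∀ i ≤ N, Q i = wt N pA p1 p2 p3 γ i / Znorm N pA p1 p2 p3 γ := by
  have hN0 : (0 : ℝ) < N := by exact_mod_cast hN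
  have hb : ∀ i ≤ N, i ≠ 0 → bwd N pA p1 p2 p3 γ i ≠ 0 := fun i hi h0 =>
    mul_ne_zero (div_ne_zero (Nat.cast_ne_zero.2 h0) hN0.ne') (sub_pos.2 (ha i hi).2).ne'
  have hW0 : wt N pA p1 p2 p3 γ 0 ≠ 0 := by
    simp only [wt, Finset.range_zero, Finset.prod_empty, one_mul]
    refine Finset.prod_ne_zero_iff.2 fun j hj => ?_
    rw [Finset.mem_Icc] at hj
    exact hb j hj.2 (by omega)
  have hprop := mul_eq_mul_of_detailed_balance
    (fun i hi => hb (i + 1) hi i.succ_ne_zero)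
    (detailed_balance_of_stationary (by simp [bwd]) hQstat)
    (fun i hi => fwd_mul_wt pA p1 p2 p3 γ hi)
  have hZ : wt N pA p1 p2 p3 γ 0 = Q 0 * Znorm N pA p1 p2 p3 γ := by
    rw [Znorm, Finset.mul_sum, ← one_mul (wt N pA p1 p2 p3 γ 0), ← hQsum, Finset.sum_mul]
    exact Finset.sum_congr rfl fun i hi => hprop i (Nat.lt_succ_iff.1 (Finset.mem_range.1 hi))
  have hQ0 : Q 0 ≠ 0 := left_ne_zero_of_mul (hZ ▸ hW0)
  have hZ0 : Znorm N pA p1 p2 p3 γ ≠ 0 := right_ne_zero_of_mul (hZ ▸ hW0)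
  intro i hi
  rw [eq_div_iff hZ0]
  apply mul_left_cancel₀ hQ0
  linear_combination hprop i hi - Q i * hZ
end

section
/- Fix N ≥ 1 and γ = 0 (only game B is played). Let Π_i denote the unnormalized stationary weights for parameters {p1, p2, p3} and Π'_i those for the reflected parameters {1-p3, 1-p2, 1-p1}. Then Π'_{N-i} = Π_i for every i ∈ {0,...,N}; consequently Z' = Z, and if Z > 0 then the stationary probabilities satisfy P'^st_{N-i} = P^st_i (Eq. (9) of the paper). -/
open Finset

theorem round_two_mul_div_three_add_round_div_three (N : ℕ) :
    round ((2 * N : ℝ) / 3) + round ((N : ℝ) / 3) = N ∧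
      round ((N : ℝ) / 3) ≤ round ((2 * N : ℝ) / 3) := by
  rw [round_eq, round_eq]
  have h1 := Int.floor_le ((2 * N : ℝ) / 3 + 1 / 2)
  have h2 := Int.lt_floor_add_one ((2 * N : ℝ) / 3 + 1 / 2)
  have h3 := Int.floor_le ((N : ℝ) / 3 + 1 / 2)
  have h4 := Int.lt_floor_add_one ((N : ℝ) / 3 + 1 / 2)
  generalize ⌊(2 * N : ℝ) / 3 + 1 / 2⌋ = a at *
  generalize ⌊(N : ℝ) / 3 + 1 / 2⌋ = b at *
  have h1' : 6 * a ≤ 4 * (N : ℤ) + 3 := by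
    have : (6 * a : ℝ) ≤ 4 * N + 3 := by linarith
    exact_mod_cast this
  have h2' : 4 * (N : ℤ) + 3 < 6 * a + 6 := by
    have : (4 * N + 3 : ℝ) < 6 * a + 6 := by linarith
    exact_mod_cast this
  have h3' : 6 * b ≤ 2 * (N : ℤ) + 3 := by
    have : (6 * b : ℝ) ≤ 2 * N + 3 := by linarith
    exact_mod_cast this
  have h4' : 2 * (N : ℤ) + 3 < 6 * b + 6 := by
    have : (2 * N + 3 : ℝ) < 6 * b + 6 := by linarith
    exact_mod_cast this
  omega

theorem gameB_reflect (N : ℕ) (p1 p2 p3 : ℝ) {i : ℕ} (hi : i ≤ N) :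
    gameB N (1 - p3) (1 - p2) (1 - p1) (N - i) = 1 - gameB N p1 p2 p3 i := by
  obtain ⟨hadd, hle⟩ := round_two_mul_div_three_add_round_div_three N
  unfold gameB
  generalize round ((2 * N : ℝ) / 3) = a at *
  generalize round ((N : ℝ) / 3) = b at *
  split_ifs <;> first | rfl | omega

theorem fwd_reflect (N : ℕ) (pA p1 p2 p3 : ℝ) {i : ℕ} (hi : i ≤ N) :
    fwd N pA (1 - p3) (1 - p2) (1 - p1) 0 (N - i) = bwd N pA p1 p2 p3 0 i := by
  unfold fwd bwd aProb
  rw [gameB_reflect N p1 p2 p3 hi, Nat.cast_sub hi]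
  ring

theorem bwd_reflect (N : ℕ) (pA p1 p2 p3 : ℝ) {i : ℕ} (hi : i ≤ N) :
    bwd N pA (1 - p3) (1 - p2) (1 - p1) 0 (N - i) = fwd N pA p1 p2 p3 0 i := by
  unfold fwd bwd aProb
  rw [gameB_reflect N p1 p2 p3 hi, Nat.cast_sub hi]
  ring

theorem wt_reflect (N : ℕ) (pA p1 p2 p3 : ℝ) {i : ℕ} (hi : i ≤ N) :
    wt N pA (1 - p3) (1 - p2) (1 - p1) 0 (N - i) = wt N pA p1 p2 p3 0 i := by
  unfold wt
  rw [mul_comm]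
  congr 1
  · symm
    refine Finset.prod_nbij' (N - ·) (N - ·) ?_ ?_ ?_ ?_ ?_ <;> intro j hj <;>
      simp only [Finset.mem_range, Finset.mem_Icc] at hj ⊢
    iterate 4 omega
    exact (bwd_reflect N pA p1 p2 p3 (by omega)).symm
  · symm
    refine Finset.prod_nbij' (N - ·) (N - ·) ?_ ?_ ?_ ?_ ?_ <;> intro j hj <;>
      simp only [Finset.mem_range, Finset.mem_Icc] at hj ⊢
    iterate 4 omega
    exact (fwd_reflect N pA p1 p2 p3 (by omega)).symm

theorem Znorm_reflect (N : ℕ) (pA p1 p2 p3 : ℝ) :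
    Znorm N pA (1 - p3) (1 - p2) (1 - p1) 0 = Znorm N pA p1 p2 p3 0 := by
  unfold Znorm
  rw [← Finset.sum_range_reflect]
  refine Finset.sum_congr rfl fun i hi => ?_
  rw [Nat.add_sub_cancel]
  exact wt_reflect N pA p1 p2 p3 (Nat.lt_succ_iff.mp (Finset.mem_range.mp hi))

/-- for `γ = 0`, the unnormalized stationary weights for the reflected
parameters `{1-p3,1-p2,1-p1}` satisfy `Π'_{N-i} = Π_i`; consequently `Z' = Z`, and if
`Z > 0` the stationary probabilities satisfy `P'^st_{N-i} = P^st_i` (Eq. (9)). -/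
theorem weights_reflect (N : ℕ) (hN : 1 ≤ N) (pA p1 p2 p3 : ℝ)
    (hp1 : p1 ∈ Set.Icc (0 : ℝ) 1) (hp2 : p2 ∈ Set.Icc (0 : ℝ) 1)
    (hp3 : p3 ∈ Set.Icc (0 : ℝ) 1) :
    (∀ i ≤ N, wt N pA (1 - p3) (1 - p2) (1 - p1) 0 (N - i) = wt N pA p1 p2 p3 0 i) ∧
      Znorm N pA (1 - p3) (1 - p2) (1 - p1) 0 = Znorm N pA p1 p2 p3 0 ∧
      (0 < Znorm N pA p1 p2 p3 0 →
        ∀ i ≤ N, Pst N pA (1 - p3) (1 - p2) (1 - p1) 0 (N - i) = Pst N pA p1 p2 p3 0 i) := by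
  refine ⟨fun i hi => wt_reflect N pA p1 p2 p3 hi, Znorm_reflect N pA p1 p2 p3,
    fun _ i hi => ?_⟩
  unfold Pst
  rw [wt_reflect N pA p1 p2 p3 hi, Znorm_reflect]
end

section
/- For N = 2 players and γ = 0, with p1, p3 ∈ (0,1) (so that (p1,p3) ≠ (1,0) and Z > 0), game B is fair — i.e. p_win = 1/2 — if and only if p2 = (p1 - 1)/(p1 - p3 - 1). -/
open Finset

theorem round_four_thirds : round ((2 * 2 : ℝ) / 3) = 1 := by
  norm_num [round_eq, Int.floor_eq_iff]

theorem round_two_thirds : round ((2 : ℝ) / 3) = 1 := by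
  norm_num [round_eq, Int.floor_eq_iff]

theorem gameB_two_zero (p1 p2 p3 : ℝ) : gameB 2 p1 p2 p3 0 = p3 := by
  simp [gameB, round_four_thirds, round_two_thirds]

theorem gameB_two_one (p1 p2 p3 : ℝ) : gameB 2 p1 p2 p3 1 = p2 := by
  simp [gameB, round_four_thirds, round_two_thirds]

theorem gameB_two_two (p1 p2 p3 : ℝ) : gameB 2 p1 p2 p3 2 = p1 := by
  simp [gameB, round_four_thirds]

theorem wt_two_zero (pA p1 p2 p3 : ℝ) :
    wt 2 pA p1 p2 p3 0 0 = (1 - p2) * (1 - p1) / 2 := by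
  have h : Finset.Icc 1 2 = {1, 2} := rfl
  simp [wt, h, bwd, aProb, gameB_two_one, gameB_two_two]
  ring

theorem wt_two_one (pA p1 p2 p3 : ℝ) :
    wt 2 pA p1 p2 p3 0 1 = p3 * (1 - p1) := by
  simp [wt, fwd, bwd, aProb, gameB_two_zero, gameB_two_two]

theorem wt_two_two (pA p1 p2 p3 : ℝ) :
    wt 2 pA p1 p2 p3 0 2 = p3 * p2 / 2 := by
  simp [wt, Finset.prod_range_succ, fwd, aProb, gameB_two_zero, gameB_two_one]
  ring

theorem Znorm_two (pA p1 p2 p3 : ℝ) :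
    Znorm 2 pA p1 p2 p3 0 =
      (1 - p2) * (1 - p1) / 2 + p3 * (1 - p1) + p3 * p2 / 2 := by
  simp [Znorm, Finset.sum_range_succ, wt_two_zero, wt_two_one, wt_two_two]

theorem pwin_two (pA p1 p2 p3 : ℝ) :
    pwin 2 pA p1 p2 p3 0 =
      (p3 * ((1 - p2) * (1 - p1) / 2) + p2 * (p3 * (1 - p1)) + p1 * (p3 * p2 / 2)) /
        ((1 - p2) * (1 - p1) / 2 + p3 * (1 - p1) + p3 * p2 / 2) := by
  simp only [pwin, Pst, Znorm_two, Finset.sum_range_succ, Finset.range_zero, Finset.sum_empty,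
    wt_two_zero, wt_two_one, wt_two_two, aProb, gameB_two_zero, gameB_two_one, gameB_two_two]
  ring

/-- for `N = 2` players and `γ = 0`, with `p1, p3 ∈ (0,1)`, game B is
fair iff `p2 = (p1 - 1)/(p1 - p3 - 1)`. -/
theorem fair_N2 (pA p1 p2 p3 : ℝ)
    (hp1 : p1 ∈ Set.Ioo (0 : ℝ) 1) (hp3 : p3 ∈ Set.Ioo (0 : ℝ) 1)
    (hp2 : p2 ∈ Set.Icc (0 : ℝ) 1) :
    pwin 2 pA p1 p2 p3 0 = 1 / 2 ↔ p2 = (p1 - 1) / (p1 - p3 - 1) := by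
  obtain ⟨_, h1⟩ := hp1
  obtain ⟨h3, _⟩ := hp3
  obtain ⟨h2, h2'⟩ := hp2
  have hq1 : 0 < 1 - p1 := sub_pos.2 h1
  have hq2 : 0 ≤ 1 - p2 := sub_nonneg.2 h2'
  have hZ : 0 < (1 - p2) * (1 - p1) / 2 + p3 * (1 - p1) + p3 * p2 / 2 := by positivity
  have hD : p1 - p3 - 1 ≠ 0 := by linarith
  rw [pwin_two, div_eq_iff hZ.ne', eq_div_iff hD]
  constructor <;> intro h <;> linarith
end

section
/- For N = 3 players and γ = 0, with p1, p3 ∈ (0,1), p1 + p3 ≠ 1, if p2 = ((p1-1)(p3+1) + sqrt((p1-2)(p1-1)·p3·(p3+1)))/(p1 + p3 - 1) and this value p2 lies in [0,1], then game B is fair: p_win = 1/2. -/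
open Finset

theorem gameB_three (p1 p2 p3 : ℝ) :
    gameB 3 p1 p2 p3 0 = p3 ∧ gameB 3 p1 p2 p3 1 = p2 ∧
      gameB 3 p1 p2 p3 2 = p2 ∧ gameB 3 p1 p2 p3 3 = p1 := by
  have hlow : round (((3 : ℕ) : ℝ) / 3) = 1 := by norm_num
  have hhigh : round ((2 * (3 : ℕ) : ℝ) / 3) = 2 := by
    rw [show (2 * (3 : ℕ) : ℝ) / 3 = ((2 : ℤ) : ℝ) by norm_num, round_intCast]
  refine ⟨?_, ?_, ?_, ?_⟩ <;> simp only [gameB, hlow, hhigh] <;> norm_num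

/-- The numerator is `Σ a_i Π_i` and the denominator `Σ Π_i`, both scaled by `9 / 2`. -/
theorem pwin_three (pA p1 p2 p3 : ℝ) :
    pwin 3 pA p1 p2 p3 0 =
      (p3 * ((1 - p2) ^ 2 * (1 - p1)) + 3 * p2 * p3 * (1 - p1) + p1 * (p3 * p2 ^ 2)) /
        ((1 - p2) ^ 2 * (1 - p1) + 3 * p3 * (1 - p1) + p3 * p2 ^ 2) := by
  obtain ⟨h0, h1, h2, h3⟩ := gameB_three p1 p2 p3
  have a0 : aProb 3 pA p1 p2 p3 0 0 = p3 := by simp [aProb, h0]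
  have a1 : aProb 3 pA p1 p2 p3 0 1 = p2 := by simp [aProb, h1]
  have a2 : aProb 3 pA p1 p2 p3 0 2 = p2 := by simp [aProb, h2]
  have a3 : aProb 3 pA p1 p2 p3 0 3 = p1 := by simp [aProb, h3]
  have w0 : wt 3 pA p1 p2 p3 0 0 = 2 / 9 * ((1 - p2) ^ 2 * (1 - p1)) := by
    simp [wt, Finset.prod_Icc_succ_top, bwd, a1, a2, a3]
    ring
  have w1 : wt 3 pA p1 p2 p3 0 1 = 2 / 9 * (3 * p3 * (1 - p2) * (1 - p1)) := by
    simp [wt, Finset.prod_Icc_succ_top, fwd, bwd, a0, a2, a3]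
    ring
  have w2 : wt 3 pA p1 p2 p3 0 2 = 2 / 9 * (3 * p3 * p2 * (1 - p1)) := by
    simp [wt, Finset.prod_range_succ, fwd, bwd, a0, a1, a3]
    ring
  have w3 : wt 3 pA p1 p2 p3 0 3 = 2 / 9 * (p3 * p2 ^ 2) := by
    simp [wt, Finset.prod_range_succ, fwd, a0, a1, a2]
    ring
  have hZ : Znorm 3 pA p1 p2 p3 0 =
      2 / 9 * ((1 - p2) ^ 2 * (1 - p1) + 3 * p3 * (1 - p1) + p3 * p2 ^ 2) := by
    simp only [Znorm, Finset.sum_range_succ, Finset.sum_range_zero, w0, w1, w2, w3]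
    ring
  rw [← mul_div_mul_left _ _ (show (2 / 9 : ℝ) ≠ 0 by norm_num), ← hZ]
  simp only [pwin, Pst, Finset.sum_range_succ, Finset.sum_range_zero,
    a0, a1, a2, a3, w0, w1, w2, w3]
  ring

/-- for `N = 3` players and `γ = 0`, with `p1, p3 ∈ (0,1)`,
`p1 + p3 ≠ 1`, if `p2` equals the given formula and lies in `[0,1]`, then game B
is fair: `p_win = 1/2`. -/
theorem fair_N3 (pA p1 p2 p3 : ℝ)
    (hp1 : p1 ∈ Set.Ioo (0 : ℝ) 1) (hp3 : p3 ∈ Set.Ioo (0 : ℝ) 1)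
    (hsum : p1 + p3 ≠ 1)
    (hp2 : p2 = ((p1 - 1) * (p3 + 1) +
        Real.sqrt ((p1 - 2) * (p1 - 1) * p3 * (p3 + 1))) / (p1 + p3 - 1))
    (hp2mem : p2 ∈ Set.Icc (0 : ℝ) 1) :
    pwin 3 pA p1 p2 p3 0 = 1 / 2 := by
  obtain ⟨-, h1⟩ := hp1
  obtain ⟨h3, -⟩ := hp3
  have hs : p1 + p3 - 1 ≠ 0 := fun h => hsum (by linarith)
  have hone : 0 < 1 - p1 := by linarith
  have hdisc : 0 ≤ (p1 - 2) * (p1 - 1) * p3 * (p3 + 1) := by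
    have : 0 < (p1 - 2) * (p1 - 1) := mul_pos_of_neg_of_neg (by linarith) (by linarith)
    positivity
  have hsq : (p2 * (p1 + p3 - 1) - (p1 - 1) * (p3 + 1)) ^ 2 =
      (p1 - 2) * (p1 - 1) * p3 * (p3 + 1) := by
    rw [← Real.sq_sqrt hdisc, (eq_div_iff hs).mp hp2, add_sub_cancel_left]
  have hquad : (p1 + p3 - 1) * p2 ^ 2 + 2 * (1 - p1) * (p3 + 1) * p2
      - (1 - p1) * (p3 + 1) = 0 := by
    apply mul_left_cancel₀ hs
    linear_combination hsq
  have hpos : 0 < (1 - p2) ^ 2 * (1 - p1) + 3 * p3 * (1 - p1) + p3 * p2 ^ 2 := by positivity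
  rw [pwin_three, div_eq_div_iff hpos.ne' two_ne_zero]
  linear_combination hquad
end

section
/- For N = 5 players and γ = 0, with p1, p3 ∈ (0,1), if p2 = (1 - (p3/(p1-1))·sqrt((5 + 2·p1·(p1-3))/(1 + 2·p3·(1+p3))))^{-1} and this value p2 lies in [0,1], then game B is fair: p_win = 1/2. -/
open Finset

/-- For five players the thresholds of game B are `round (10 / 3) = 3` and `round (5 / 3) = 2`. -/
lemma gameB_five (p1 p2 p3 : ℝ) (i : ℕ) :
    gameB 5 p1 p2 p3 i = if 3 < i then p1 else if 2 ≤ i then p2 else p3 := by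
  have h1 : round ((2 * (5 : ℕ) : ℝ) / 3) = 3 := by
    rw [round_eq, Int.floor_eq_iff]; norm_num
  have h2 : round (((5 : ℕ) : ℝ) / 3) = 2 := by
    rw [round_eq, Int.floor_eq_iff]; norm_num
  unfold gameB
  rw [h1, h2]
  norm_cast

/-- A polynomial form of the fairness condition of game B for five players. -/
lemma pwin_five_eq_half (pA p1 p2 p3 : ℝ) (hp1 : p1 ∈ Set.Ioo (0 : ℝ) 1)
    (hp2 : p2 ∈ Set.Ioo (0 : ℝ) 1) (hp3 : p3 ∈ Set.Ioo (0 : ℝ) 1)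
    (h : p2 ^ 2 * p3 ^ 2 * (5 + 2 * p1 * (p1 - 3)) =
      (1 - p1) ^ 2 * (1 - p2) ^ 2 * (1 + 2 * p3 * (1 + p3))) :
    pwin 5 pA p1 p2 p3 0 = 1 / 2 := by
  obtain ⟨h1, h1'⟩ := hp1
  obtain ⟨h2, h2'⟩ := hp2
  obtain ⟨h3, h3'⟩ := hp3
  have hu1 := sub_pos.2 h1'
  have hu2 := sub_pos.2 h2'
  have hu3 := sub_pos.2 h3'
  have hIcc : ∀ k, Finset.Icc k 5 = (Finset.range 6).filter (k ≤ ·) := by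
    intro k; ext; simp only [mem_Icc, mem_filter, mem_range]; omega
  have hZ : 0 < Znorm 5 pA p1 p2 p3 0 := by
    simp only [Znorm, wt, hIcc, Finset.prod_filter, Finset.sum_range_succ, Finset.prod_range_succ,
      Finset.sum_range_zero, Finset.prod_range_zero, fwd, bwd, aProb, gameB_five]
    norm_num
    positivity
  have hsum : pwin 5 pA p1 p2 p3 0 =
      (∑ i ∈ Finset.range 6, aProb 5 pA p1 p2 p3 0 i * wt 5 pA p1 p2 p3 0 i) /
        Znorm 5 pA p1 p2 p3 0 := by
    simp only [pwin, Pst, Finset.sum_div, mul_div_assoc]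
  rw [hsum, div_eq_div_iff hZ.ne' two_ne_zero]
  simp only [Znorm, wt, hIcc, Finset.prod_filter, Finset.sum_range_succ, Finset.prod_range_succ,
    Finset.sum_range_zero, Finset.prod_range_zero, fwd, bwd, aProb, gameB_five]
  norm_num
  linear_combination (24 / 625) * h

/-- for `N = 5` players and `γ = 0`, with `p1, p3 ∈ (0,1)`, if `p2`
equals the given formula and lies in `[0,1]`, then game B is fair: `p_win = 1/2`. -/
theorem fair_N5 (pA p1 p2 p3 : ℝ)
    (hp1 : p1 ∈ Set.Ioo (0 : ℝ) 1) (hp3 : p3 ∈ Set.Ioo (0 : ℝ) 1)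
    (hp2 : p2 = (1 - (p3 / (p1 - 1)) *
        Real.sqrt ((5 + 2 * p1 * (p1 - 3)) / (1 + 2 * p3 * (1 + p3))))⁻¹)
    (hp2mem : p2 ∈ Set.Icc (0 : ℝ) 1) :
    pwin 5 pA p1 p2 p3 0 = 1 / 2 := by
  obtain ⟨h1, h1'⟩ := hp1
  have h3 := hp3.1
  have hu := sub_pos.2 h1'
  have hA : 0 < 5 + 2 * p1 * (p1 - 3) := by nlinarith
  have hB : 0 < 1 + 2 * p3 * (1 + p3) := by positivity
  set s := Real.sqrt ((5 + 2 * p1 * (p1 - 3)) / (1 + 2 * p3 * (1 + p3))) with hs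
  have hs0 : 0 < s := Real.sqrt_pos.2 (div_pos hA hB)
  have hs2 : s ^ 2 * (1 + 2 * p3 * (1 + p3)) = 5 + 2 * p1 * (p1 - 3) := by
    rw [hs, Real.sq_sqrt (div_pos hA hB).le, div_mul_cancel₀ _ hB.ne']
  have hden : 0 < 1 - p1 + p3 * s := by positivity
  have hp2' : p2 = (1 - p1) / (1 - p1 + p3 * s) := by
    have hfactor : 1 - p3 / (p1 - 1) * s = (1 - p1 + p3 * s) / (1 - p1) := by
      rw [← neg_sub 1 p1]
      field_simp
      ring
    rw [hp2, hfactor, inv_div]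
  have hlin : p2 * (1 - p1 + p3 * s) = 1 - p1 := by
    rw [hp2', div_mul_cancel₀ _ hden.ne']
  have hlt : p2 < 1 := by
    rw [hp2', div_lt_one hden]
    linarith [mul_pos h3 hs0]
  refine pwin_five_eq_half pA p1 p2 p3 ⟨h1, h1'⟩ ⟨hp2' ▸ div_pos hu hden, hlt⟩ hp3 ?_
  have hodds : p2 * p3 * s = (1 - p1) * (1 - p2) := by linear_combination hlin
  rw [← hs2, ← mul_pow (1 - p1), ← hodds]
  ring
end

section
/- Current inversion (main result, explicit instance): for N = 3 players, p_A = 1/2 (game A fair), p1 = 0.686, p3 = 0.8, and p2 = ((p1-1)(p3+1) + sqrt((p1-2)(p1-1)·p3·(p3+1)))/(p1 + p3 - 1) (the value making game B fair, approximately 0.423), there exist mixing probabilities γ1, γ2 ∈ (0,1) with γ1 < γ2 such that J^{A+B}(γ1) < 0 < J^{A+B}(γ2); that is, the combination of the two fair games is losing for some γ and winning for other γ. -/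
open Finset

/-- The current for three players as an explicit rational function of the mixed winning
probabilities `x`, `y`, `z` at the states `0`, `{1, 2}` and `3`. -/
theorem current_three_eq {pA p1 p2 p3 γ x y z : ℝ}
    (hx : γ * pA + (1 - γ) * p3 = x) (hy : γ * pA + (1 - γ) * p2 = y)
    (hz : γ * pA + (1 - γ) * p1 = z) (hx0 : 0 < x) (hy0 : 0 < y) (hz1 : z < 1) :
    current 3 pA p1 p2 p3 γ =
      ((2 * x - 1) * (1 - y) ^ 2 * (1 - z) + 3 * x * (2 * y - 1) * (1 - z)
          + (2 * z - 1) * x * y ^ 2) /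
        ((1 - y) ^ 2 * (1 - z) + 3 * x * (1 - z) + x * y ^ 2) := by
  obtain ⟨g0, g1, g2, g3⟩ := gameB_three p1 p2 p3
  have hz' : 0 < 1 - z := sub_pos.2 hz1
  have hD : (1 - y) ^ 2 * (1 - z) + 3 * x * (1 - z) + x * y ^ 2 ≠ 0 := by positivity
  have i1 : Finset.Icc 1 3 = {1, 2, 3} := by decide
  have i2 : Finset.Icc 2 3 = {2, 3} := by decide
  have w0 : wt 3 pA p1 p2 p3 γ 0 = 2 / 9 * ((1 - y) ^ 2 * (1 - z)) := by
    simp [wt, bwd, aProb, i1, g1, g2, g3, hy, hz]; ring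
  have w1 : wt 3 pA p1 p2 p3 γ 1 = 2 / 9 * (3 * x * (1 - y) * (1 - z)) := by
    simp [wt, fwd, bwd, aProb, i2, g0, g2, g3, hx, hy, hz]; ring
  have w2 : wt 3 pA p1 p2 p3 γ 2 = 2 / 9 * (3 * x * y * (1 - z)) := by
    simp [wt, fwd, bwd, aProb, Finset.prod_range_succ, g0, g1, g3, hx, hy, hz]; ring
  have w3 : wt 3 pA p1 p2 p3 γ 3 = 2 / 9 * (x * y ^ 2) := by
    simp [wt, fwd, aProb, Finset.prod_range_succ, g0, g1, g2, hx, hy]; ring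
  have hZ : Znorm 3 pA p1 p2 p3 γ =
      2 / 9 * ((1 - y) ^ 2 * (1 - z) + 3 * x * (1 - z) + x * y ^ 2) := by
    simp only [Znorm, Finset.sum_range_succ, Finset.sum_range_zero, w0, w1, w2, w3]; ring
  simp only [current, pwin, Pst, Finset.sum_range_succ, Finset.sum_range_zero, hZ,
    w0, w1, w2, w3, aProb, g0, g1, g2, g3, hx, hy, hz]
  field_simp
  ring

theorem fair_p2_mem_Ioo :
    (((0.686 - 1) * (0.8 + 1) + Real.sqrt ((0.686 - 2) * (0.686 - 1) * 0.8 * (0.8 + 1))) /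
      (0.686 + 0.8 - 1) : ℝ) ∈ Set.Ioo (0.42305 : ℝ) 0.42306 := by
  constructor
  · rw [lt_div_iff₀ (by norm_num), ← sub_lt_iff_lt_add']
    apply Real.lt_sqrt_of_sq_lt
    norm_num
  · rw [div_lt_iff₀ (by norm_num), ← lt_sub_iff_add_lt', Real.sqrt_lt' (by norm_num)]
    norm_num

/-- current inversion, explicit instance: for `N = 3`, `p_A = 1/2`,
`p1 = 0.686`, `p3 = 0.8` and `p2` the fair-game-B value (≈ 0.423), there exist
`γ1 < γ2` in `(0,1)` with `J^{A+B}(γ1) < 0 < J^{A+B}(γ2)`. -/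
theorem current_inversion_N3 :
    ∃ γ1 ∈ Set.Ioo (0 : ℝ) 1, ∃ γ2 ∈ Set.Ioo (0 : ℝ) 1, γ1 < γ2 ∧
      current 3 (1 / 2) 0.686
          (((0.686 - 1) * (0.8 + 1) +
              Real.sqrt ((0.686 - 2) * (0.686 - 1) * 0.8 * (0.8 + 1))) /
            (0.686 + 0.8 - 1))
          0.8 γ1 < 0 ∧
      0 < current 3 (1 / 2) 0.686
          (((0.686 - 1) * (0.8 + 1) +
              Real.sqrt ((0.686 - 2) * (0.686 - 1) * 0.8 * (0.8 + 1))) /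
            (0.686 + 0.8 - 1))
          0.8 γ2 := by
  generalize hp : (((0.686 - 1) * (0.8 + 1) +
    Real.sqrt ((0.686 - 2) * (0.686 - 1) * 0.8 * (0.8 + 1))) / (0.686 + 0.8 - 1) : ℝ) = p
  obtain ⟨hl, hu⟩ := hp ▸ fair_p2_mem_Ioo
  refine ⟨1 / 5, by norm_num, 4 / 5, by norm_num, by norm_num, ?_, ?_⟩
  · rw [current_three_eq (x := 0.74) (y := 0.1 + 0.8 * p) (z := 0.6488)
      (by norm_num) (by ring) (by norm_num) (by norm_num) (by linarith) (by norm_num)]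
    apply div_neg_of_neg_of_pos
    · nlinarith
    · positivity
  · rw [current_three_eq (x := 0.56) (y := 0.4 + 0.2 * p) (z := 0.5372)
      (by norm_num) (by ring) (by norm_num) (by norm_num) (by linarith) (by norm_num)]
    apply div_pos
    · nlinarith
    · positivity
end
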